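/- Let G = (S, A) be a unit matrix hypergraph with sampling probabilities p_i ∈ (0,1], and let d̂ be the modified distance. Let a > 0 and λ ≥ 256·√40, and let H_1, …, H_t ⊆ ℝ^n be (a, λ)-separated sets for d̂. Then for any distinct i, j ∈ [t] and any y_i in the convex hull of H_i and y_j in the convex hull of H_j: d̂(y_i, y_j) ≥ a/128. -/

import Mathlib

open Finset Matrix Real MeasureTheory
open scoped Classical

/-- `gval A T x = max_{j ∈ T} |⟨a_j, x⟩|`, where `a_j` are the rows of `A`. -/
noncomputable def gval {m n : ℕ} (A : Matrix (Fin m) (Fin n) ℝ) (T : Finset (Fin m))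
    (x : Fin n → ℝ) : ℝ :=
  if h : T.Nonempty then T.sup' h (fun j => |A j ⬝ᵥ x|) else 0

/-- The modified distance
`d̂(x,y) = (Σ_i 1_{p_i ≠ 1} p_i⁻¹ (g_i(x) + g_i(y))² g_i(x-y)²)^{1/2}`. -/
noncomputable def dHat {m n k : ℕ} (A : Matrix (Fin m) (Fin n) ℝ)
    (S : Fin k → Finset (Fin m)) (p : Fin k → ℝ) (x y : Fin n → ℝ) : ℝ :=
  Real.sqrt (∑ i, (if p i = 1 then 0 else (p i)⁻¹) *
    (gval A (S i) x + gval A (S i) y) ^ 2 * (gval A (S i) (x - y)) ^ 2)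

section gval

variable {m n : ℕ} (A : Matrix (Fin m) (Fin n) ℝ) (T : Finset (Fin m))

theorem gval_nonneg (x : Fin n → ℝ) : 0 ≤ gval A T x := by
  unfold gval
  split_ifs with h
  · obtain ⟨j, hj⟩ := h
    exact (abs_nonneg _).trans (Finset.le_sup' (fun j => |A j ⬝ᵥ x|) hj)
  · exact le_rfl

theorem gval_add_le (x y : Fin n → ℝ) : gval A T (x + y) ≤ gval A T x + gval A T y := by
  unfold gval
  split_ifs with h
  · refine Finset.sup'_le _ _ fun j hj => ?_
    rw [dotProduct_add]
    exact (abs_add_le _ _).trans (add_le_add (Finset.le_sup' (fun j => |A j ⬝ᵥ x|) hj)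
      (Finset.le_sup' (fun j => |A j ⬝ᵥ y|) hj))
  · simp

theorem gval_smul_le {r : ℝ} (hr : 0 ≤ r) (x : Fin n → ℝ) :
    gval A T (r • x) ≤ r * gval A T x := by
  unfold gval
  split_ifs with h
  · refine Finset.sup'_le _ _ fun j hj => ?_
    rw [dotProduct_smul, smul_eq_mul, abs_mul, abs_of_nonneg hr]
    exact mul_le_mul_of_nonneg_left (Finset.le_sup' (fun j => |A j ⬝ᵥ x|) hj) hr
  · simp

theorem gval_sub_comm (x y : Fin n → ℝ) : gval A T (x - y) = gval A T (y - x) := by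
  unfold gval
  simp only [dotProduct_sub, abs_sub_comm]

theorem gval_le_add_sub (x y : Fin n → ℝ) : gval A T x ≤ gval A T y + gval A T (x - y) := by
  simpa using gval_add_le A T y (x - y)

theorem gval_sub_le_add_sub (x y z : Fin n → ℝ) :
    gval A T (x - z) ≤ gval A T (x - y) + gval A T (y - z) := by
  simpa using gval_add_le A T (x - y) (y - z)

theorem gval_sub_le_add (x y : Fin n → ℝ) : gval A T (x - y) ≤ gval A T x + gval A T y := by
  have h := gval_sub_le_add_sub A T x 0 y
  rwa [gval_sub_comm A T 0 y, sub_zero, sub_zero] at h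

theorem convexOn_gval_sub (x : Fin n → ℝ) :
    ConvexOn ℝ Set.univ fun y => gval A T (x - y) := by
  refine ⟨convex_univ, fun y _ z _ r s hr hs hrs => ?_⟩
  have h : x - (r • y + s • z) = r • (x - y) + s • (x - z) := by
    rw [smul_sub, smul_sub, sub_add_sub_comm, ← add_smul, hrs, one_smul]
  simp only [h, smul_eq_mul]
  exact (gval_add_le A T _ _).trans
    (add_le_add (gval_smul_le A T hr _) (gval_smul_le A T hs _))

/-- Four-point quasi-triangle inequality for one summand of the modified distance. -/
theorem gval_add_mul_gval_sub_sq_le (x y z w : Fin n → ℝ) :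
    (gval A T x + gval A T w) ^ 2 * gval A T (x - w) ^ 2 ≤
      81 * ((gval A T x + gval A T y) ^ 2 * gval A T (x - y) ^ 2 +
        (gval A T y + gval A T z) ^ 2 * gval A T (y - z) ^ 2 +
        (gval A T z + gval A T w) ^ 2 * gval A T (z - w) ^ 2) := by
  have hx := gval_nonneg A T x
  have hy := gval_nonneg A T y
  have hz := gval_nonneg A T z
  have hw := gval_nonneg A T w
  have hxw := gval_nonneg A T (x - w)
  have hxy := gval_le_add_sub A T x y
  have hyz := gval_le_add_sub A T y z
  have hzy := gval_le_add_sub A T z y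
  have hwz := gval_le_add_sub A T w z
  rw [gval_sub_comm A T z y] at hzy
  rw [gval_sub_comm A T w z] at hwz
  have sxy := gval_sub_le_add A T x y
  have syz := gval_sub_le_add A T y z
  have szw := gval_sub_le_add A T z w
  have h4 : gval A T (x - w) ≤ gval A T (x - y) + (gval A T (y - z) + gval A T (z - w)) :=
    (gval_sub_le_add_sub A T x y w).trans
      (add_le_add le_rfl (gval_sub_le_add_sub A T y z w))
  have key : ∀ u v : ℝ, gval A T x + gval A T w ≤ 3 * u → gval A T (x - w) ≤ 3 * v →
      (gval A T x + gval A T w) ^ 2 * gval A T (x - w) ^ 2 ≤ 81 * (u ^ 2 * v ^ 2) := by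
    intro u v hu hv
    calc _ ≤ (3 * u) ^ 2 * (3 * v) ^ 2 := by gcongr
      _ = _ := by ring
  have p1 := mul_nonneg (sq_nonneg (gval A T x + gval A T y)) (sq_nonneg (gval A T (x - y)))
  have p2 := mul_nonneg (sq_nonneg (gval A T y + gval A T z)) (sq_nonneg (gval A T (y - z)))
  have p3 := mul_nonneg (sq_nonneg (gval A T z + gval A T w)) (sq_nonneg (gval A T (z - w)))
  rcases le_total (gval A T (x - y)) (gval A T (y - z)) with h1 | h1 <;>
    rcases le_total (gval A T (y - z)) (gval A T (z - w)) with h2 | h2 <;>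
    rcases le_total (gval A T (x - y)) (gval A T (z - w)) with h3 | h3
  all_goals first
    | linarith [key (gval A T x + gval A T y) (gval A T (x - y)) (by linarith) (by linarith)]
    | linarith [key (gval A T y + gval A T z) (gval A T (y - z)) (by linarith) (by linarith)]
    | linarith [key (gval A T z + gval A T w) (gval A T (z - w)) (by linarith) (by linarith)]

end gval

section dHat

variable {m n k : ℕ} (A : Matrix (Fin m) (Fin n) ℝ) (S : Fin k → Finset (Fin m))
  {p : Fin k → ℝ}

theorem dHat_weight_nonneg (hp : ∀ i, 0 < p i) (i : Fin k) :
    0 ≤ if p i = 1 then 0 else (p i)⁻¹ := by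
  split_ifs
  · exact le_rfl
  · exact (inv_pos.2 (hp i)).le

theorem dHat_sq (hp : ∀ i, 0 < p i) (x y : Fin n → ℝ) :
    dHat A S p x y ^ 2 = ∑ i, (if p i = 1 then 0 else (p i)⁻¹) *
      ((gval A (S i) x + gval A (S i) y) ^ 2 * gval A (S i) (x - y) ^ 2) := by
  unfold dHat
  simp only [mul_assoc]
  exact Real.sq_sqrt (Finset.sum_nonneg fun i _ =>
    mul_nonneg (dHat_weight_nonneg hp i) (by positivity))

theorem dHat_comm (x y : Fin n → ℝ) : dHat A S p x y = dHat A S p y x := by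
  unfold dHat
  congr 1
  refine Finset.sum_congr rfl fun i _ => ?_
  rw [gval_sub_comm, add_comm (gval A (S i) x)]

theorem dHat_sq_le_add_add (hp : ∀ i, 0 < p i) (x y z w : Fin n → ℝ) :
    dHat A S p x w ^ 2 ≤
      81 * (dHat A S p x y ^ 2 + dHat A S p y z ^ 2 + dHat A S p z w ^ 2) := by
  simp only [dHat_sq A S hp, ← Finset.sum_add_distrib, Finset.mul_sum]
  refine Finset.sum_le_sum fun i _ => ?_
  refine (mul_le_mul_of_nonneg_left (gval_add_mul_gval_sub_sq_le A (S i) x y z w)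
    (dHat_weight_nonneg hp i)).trans_eq ?_
  ring

/-- The squared modified distance to `x` is equivalent, up to a factor `9`, to a function that is
convex in the other argument. -/
theorem convexOn_dHat_majorant (hp : ∀ i, 0 < p i) (x : Fin n → ℝ) :
    ConvexOn ℝ Set.univ fun y => ∑ i, (if p i = 1 then 0 else (p i)⁻¹) *
      (2 * gval A (S i) x * gval A (S i) (x - y) + gval A (S i) (x - y) ^ 2) ^ 2 := by
  have h : ∀ i ∈ Finset.univ, ConvexOn ℝ Set.univ fun y => (if p i = 1 then 0 else (p i)⁻¹) *
      (2 * gval A (S i) x * gval A (S i) (x - y) + gval A (S i) (x - y) ^ 2) ^ 2 := by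
    intro i _
    have hg := convexOn_gval_sub A (S i) x
    have hx := gval_nonneg A (S i) x
    have hn : ∀ y, 0 ≤ gval A (S i) (x - y) := fun y => gval_nonneg A (S i) _
    have h1 := (hg.smul (mul_nonneg zero_le_two hx)).add (hg.pow (fun y _ => hn y) 2)
    have h2 := h1.pow (fun y _ => by
      have := hn y
      simp only [Pi.add_apply, Pi.pow_apply, smul_eq_mul]
      positivity) 2
    exact h2.smul (dHat_weight_nonneg hp i)
  refine ⟨convex_univ, fun y hy z hz r s hr hs hrs => ?_⟩
  simp only [smul_eq_mul, Finset.mul_sum, ← Finset.sum_add_distrib]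
  exact Finset.sum_le_sum fun i hi => (h i hi).2 hy hz hr hs hrs

theorem dHat_le_of_mem_convexHull (hp : ∀ i, 0 < p i) {x : Fin n → ℝ} {ρ : ℝ} (hρ : 0 ≤ ρ)
    {H : Set (Fin n → ℝ)} (hH : H ⊆ {y | dHat A S p x y ≤ ρ}) {y : Fin n → ℝ}
    (hy : y ∈ convexHull ℝ H) : dHat A S p x y ≤ 3 * ρ := by
  have hmem := convexHull_min (fun z hz => ?_)
    ((convexOn_dHat_majorant A S hp x).convex_le (9 * ρ ^ 2)) hy
  · refine abs_le_of_sq_le_sq' ?_ (by positivity) |>.2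
    rw [dHat_sq A S hp]
    refine (Finset.sum_le_sum fun i _ => mul_le_mul_of_nonneg_left ?_
      (dHat_weight_nonneg hp i)).trans (hmem.2.trans_eq (by ring))
    have h1 := gval_nonneg A (S i) x
    have h2 := gval_nonneg A (S i) y
    have h3 := gval_nonneg A (S i) (x - y)
    have h4 := gval_le_add_sub A (S i) y x
    rw [gval_sub_comm A (S i) y x] at h4
    rw [← mul_pow]
    gcongr
    nlinarith
  · refine ⟨Set.mem_univ _, ?_⟩
    have hz' : dHat A S p x z ≤ ρ := hH hz
    have hsq : 9 * dHat A S p x z ^ 2 ≤ 9 * ρ ^ 2 := by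
      have : 0 ≤ dHat A S p x z := Real.sqrt_nonneg _
      gcongr
    refine le_trans ?_ hsq
    rw [dHat_sq A S hp, Finset.mul_sum]
    refine Finset.sum_le_sum fun i _ => ?_
    rw [mul_left_comm]
    refine mul_le_mul_of_nonneg_left ?_ (dHat_weight_nonneg hp i)
    have h1 := gval_nonneg A (S i) x
    have h2 := gval_nonneg A (S i) z
    have h3 := gval_nonneg A (S i) (x - z)
    have h4 := gval_sub_le_add A (S i) x z
    calc _ ≤ (3 * ((gval A (S i) x + gval A (S i) z) * gval A (S i) (x - z))) ^ 2 := by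
          gcongr
          nlinarith
      _ = _ := by ring

end dHat

theorem stmt_17 {m n k : ℕ} (A : Matrix (Fin m) (Fin n) ℝ)
    (S : Fin k → Finset (Fin m))
    -- `S` is a partition of `[m]` into nonempty groups
    (hS : ∀ i, (S i).Nonempty)
    (hdisj : ∀ i j, i ≠ j → Disjoint (S i) (S j))
    (hcover : ∀ a : Fin m, ∃ i, a ∈ S i)
    -- sampling probabilities
    (p : Fin k → ℝ) (hp : ∀ i, 0 < p i ∧ p i ≤ 1)
    (a : ℝ) (ha : 0 < a) (lam : ℝ) (hlam : 256 * Real.sqrt 40 ≤ lam)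
    -- `H_1, …, H_t` are `(a, λ)`-separated sets for `d̂` with centers `c_1, …, c_t`
    (t : ℕ) (H : Fin t → Set (Fin n → ℝ)) (c : Fin t → (Fin n → ℝ))
    (hsep : ∀ i j, i ≠ j → a ≤ dHat A S p (c i) (c j))
    (hin : ∀ i, H i ⊆ {y : Fin n → ℝ | dHat A S p (c i) y ≤ a / lam}) :
    ∀ i j, i ≠ j →
      ∀ yi ∈ convexHull ℝ (H i), ∀ yj ∈ convexHull ℝ (H j),
        a / 128 ≤ dHat A S p yi yj := by
  intro i j hij yi hyi yj hyj
  have hp0 : ∀ i, 0 < p i := fun i => (hp i).1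
  have hlam' : 1536 ≤ lam := by
    have : (6 : ℝ) ≤ Real.sqrt 40 := Real.le_sqrt_of_sq_le (by norm_num)
    linarith
  have hρ : 0 ≤ a / lam := div_nonneg ha.le (by linarith)
  have hρ' : a / lam ≤ a / 1536 := div_le_div_of_nonneg_left ha.le (by norm_num) hlam'
  have hnn : ∀ x y, 0 ≤ dHat A S p x y := fun x y => Real.sqrt_nonneg _
  have hi := dHat_le_of_mem_convexHull A S hp0 hρ (hin i) hyi
  have hj := dHat_le_of_mem_convexHull A S hp0 hρ (hin j) hyj
  rw [dHat_comm] at hj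
  have hi2 : dHat A S p (c i) yi ^ 2 ≤ (a / 512) ^ 2 :=
    pow_le_pow_left₀ (hnn _ _) (by linarith) 2
  have hj2 : dHat A S p yj (c j) ^ 2 ≤ (a / 512) ^ 2 :=
    pow_le_pow_left₀ (hnn _ _) (by linarith) 2
  have hs : a ^ 2 ≤ dHat A S p (c i) (c j) ^ 2 := pow_le_pow_left₀ ha.le (hsep i j hij) 2
  have hq := dHat_sq_le_add_add A S hp0 (c i) yi yj (c j)
  refine (abs_le_of_sq_le_sq' ?_ (hnn _ _)).2
  nlinarith [sq_nonneg a]
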